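/- There exists a finite semifield D with exactly 64 elements that is one-sided nonprimitive: D possesses a left-primitive element or a right-primitive element, but not both (i.e., exactly one of the two statements 'D has a left-primitive element' and 'D has a right-primitive element' holds). -/

import Mathlib

/-- A finite semifield: a finite nonassociative ring with identity in which
the product of any two nonzero elements is nonzero. -/
structure FiniteSemifield where
  D : Type
  [addGroup : AddCommGroup D]
  mul : D → D → D
  one : D
  finite : Finite D
  mul_add : ∀ a b c : D, mul a (b + c) = mul a b + mul a c
  add_mul : ∀ a b c : D, mul (a + b) c = mul a c + mul b c
  one_mul : ∀ a : D, mul one a = a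
  mul_one : ∀ a : D, mul a one = a
  one_ne_zero : one ≠ (0 : D)
  noZeroDiv : ∀ a b : D, mul a b = 0 → a = 0 ∨ b = 0

attribute [instance] FiniteSemifield.addGroup

/-- Left powers: `S.lpow a n` is `a^(n+1)`, where `a^(1) = a` and
`a^(n+1) = a · a^(n)`. -/
def FiniteSemifield.lpow (S : FiniteSemifield) (a : S.D) : ℕ → S.D
  | 0 => a
  | n + 1 => S.mul a (S.lpow a n)

/-- Right powers: `S.rpow a n` is `a^[n+1]`, where `a^[1] = a` and
`a^[n+1] = a^[n] · a`. -/
def FiniteSemifield.rpow (S : FiniteSemifield) (a : S.D) : ℕ → S.D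
  | 0 => a
  | n + 1 => S.mul (S.rpow a n) a

/-- An element is left-primitive if every nonzero element is a left power of it. -/
def FiniteSemifield.IsLeftPrimitive (S : FiniteSemifield) (a : S.D) : Prop :=
  ∀ x : S.D, x ≠ 0 → ∃ n : ℕ, S.lpow a n = x

/-- An element is right-primitive if every nonzero element is a right power of it. -/
def FiniteSemifield.IsRightPrimitive (S : FiniteSemifield) (a : S.D) : Prop :=
  ∀ x : S.D, x ≠ 0 → ∃ n : ℕ, S.rpow a n = x

namespace BitVec

/-- The `𝔽₂`-linear combination of `c 0, …, c 5` whose coefficients are the bits of `x`. -/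
def linComb (c : ℕ → BitVec 6) (x : BitVec 6) : BitVec 6 :=
  (bif x.getLsbD 0 then c 0 else 0#6) ^^^
  (bif x.getLsbD 1 then c 1 else 0#6) ^^^
  (bif x.getLsbD 2 then c 2 else 0#6) ^^^
  (bif x.getLsbD 3 then c 3 else 0#6) ^^^
  (bif x.getLsbD 4 then c 4 else 0#6) ^^^
  (bif x.getLsbD 5 then c 5 else 0#6)

theorem cond_bne_zero (p q : Bool) (v : BitVec 6) :
    (bif p ^^ q then v else 0#6) = (bif p then v else 0#6) ^^^ (bif q then v else 0#6) := by
  cases p <;> cases q <;> simp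

theorem cond_xor_zero (p : Bool) (v w : BitVec 6) :
    (bif p then v ^^^ w else 0#6) = (bif p then v else 0#6) ^^^ (bif p then w else 0#6) := by
  cases p <;> simp

theorem linComb_xor (c : ℕ → BitVec 6) (x y : BitVec 6) :
    linComb c (x ^^^ y) = linComb c x ^^^ linComb c y := by
  simp only [linComb, getLsbD_xor, cond_bne_zero]
  ac_rfl

theorem linComb_xor_left (c d : ℕ → BitVec 6) (x : BitVec 6) :
    linComb (fun i => c i ^^^ d i) x = linComb c x ^^^ linComb d x := by
  simp only [linComb, cond_xor_zero]
  ac_rfl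

/-- Addition in `𝔽₂⁶`. -/
abbrev xorAddCommGroup : AddCommGroup (BitVec 6) where
  add x y := x ^^^ y
  zero := 0#6
  neg x := x
  sub x y := x ^^^ y
  sub_eq_add_neg _ _ := rfl
  add_assoc := BitVec.xor_assoc
  zero_add x := BitVec.zero_xor
  add_zero x := BitVec.xor_zero
  add_comm := BitVec.xor_comm
  neg_add_cancel x := BitVec.xor_self
  nsmul := @nsmulRec _ ⟨0#6⟩ ⟨fun x y => x ^^^ y⟩
  zsmul := @zsmulRec _ ⟨0#6⟩ ⟨fun x y => x ^^^ y⟩ ⟨fun x => x⟩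
    (@nsmulRec _ ⟨0#6⟩ ⟨fun x y => x ^^^ y⟩)

/-- Row `i` lists the products `eᵢ e₀, …, eᵢ e₅` of the standard basis vectors of `𝔽₂⁶`. -/
def semifieldTable : List (List (BitVec 6)) :=
  [[1, 2, 4, 8, 16, 32], [2, 4, 8, 24, 56, 49], [4, 8, 19, 40, 9, 34],
   [8, 16, 43, 7, 12, 10], [16, 32, 22, 9, 10, 13], [32, 27, 40, 34, 14, 16]]

/-- The bilinear product on `𝔽₂⁶` with structure constants `semifieldTable`. -/
def semifieldMul (x y : BitVec 6) : BitVec 6 :=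
  linComb (fun i => linComb (fun j => (semifieldTable.getD i []).getD j 0#6) y) x

theorem semifieldMul_one (a : BitVec 6) : semifieldMul a 1#6 = a := by
  revert a; decide +kernel

theorem one_semifieldMul (a : BitVec 6) : semifieldMul 1#6 a = a := by
  revert a; decide +kernel

theorem eq_zero_or_eq_zero_of_semifieldMul (a b : BitVec 6) :
    semifieldMul a b = 0#6 → a = 0#6 ∨ b = 0#6 := by
  revert a b; decide +kernel

end BitVec

namespace FiniteSemifield

open BitVec in
/-- The semifield of order 64 with structure constants `BitVec.semifieldTable`. -/
def order64 : FiniteSemifield where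
  D := BitVec 6
  addGroup := xorAddCommGroup
  mul := semifieldMul
  one := 1#6
  finite := Finite.of_injective BitVec.toFin fun _ _ => BitVec.eq_of_toFin_eq
  mul_add a b c := by
    change semifieldMul a (b ^^^ c) = semifieldMul a b ^^^ semifieldMul a c
    simp only [semifieldMul, linComb_xor, linComb_xor_left]
  add_mul a b c := linComb_xor _ a b
  one_mul := one_semifieldMul
  mul_one := semifieldMul_one
  one_ne_zero := by change 1#6 ≠ 0#6; decide
  noZeroDiv := eq_zero_or_eq_zero_of_semifieldMul

theorem card_order64 : Nat.card order64.D = 64 := by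
  change Nat.card (BitVec 6) = 64
  rw [Nat.card_congr ⟨BitVec.toFin, BitVec.ofFin, fun _ => rfl, fun _ => rfl⟩]
  simp

/-- A periodic sequence of left powers takes too few values for the element to be
left-primitive. -/
theorem not_isLeftPrimitive_of_lpow_eq (S : FiniteSemifield) {a : S.D} {m : ℕ} (hm : 0 < m)
    (hcard : m + 1 < Nat.card S.D) (h : S.lpow a m = a) : ¬ S.IsLeftPrimitive a := by
  intro ha
  have := S.finite
  have hper : Function.Periodic (S.lpow a) m := by
    intro n
    induction n with
    | zero => simpa [lpow] using h
    | succ n ih => rw [Nat.add_right_comm]; simp only [lpow, ih]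
  have hsub : (Set.univ : Set S.D) ⊆ insert 0 (S.lpow a '' Set.Iio m) := by
    intro x _
    by_cases hx : x = 0
    · exact Or.inl hx
    · obtain ⟨n, rfl⟩ := ha x hx
      exact Or.inr ⟨n % m, Nat.mod_lt _ hm, hper.map_mod_nat n⟩
  have h1 := Set.ncard_le_ncard hsub (Set.toFinite _)
  have h2 := Set.ncard_insert_le 0 (S.lpow a '' Set.Iio m)
  have h3 := Set.ncard_image_le (f := S.lpow a) (Set.finite_Iio m)
  rw [Set.ncard_univ] at h1
  rw [Set.ncard_Iio_nat] at h3
  omega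

theorem lpow_eq_iterate (S : FiniteSemifield) (a : S.D) (n : ℕ) :
    S.lpow a n = (S.mul a)^[n] a := by
  induction n with
  | zero => rfl
  | succ n ih => rw [Function.iterate_succ_apply', lpow, ih]

theorem rpow_eq_iterate (S : FiniteSemifield) (a : S.D) (n : ℕ) :
    S.rpow a n = (S.mul · a)^[n] a := by
  induction n with
  | zero => rfl
  | succ n ih => rw [Function.iterate_succ_apply', rpow, ih]

theorem exists_lpow_eq_order64 (a : order64.D) : ∃ m < 15, order64.lpow a (m + 1) = a := by
  have h : ∀ a : BitVec 6, ∃ m < 15, (BitVec.semifieldMul a)^[m + 1] a = a := by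
    decide +kernel
  simp only [lpow_eq_iterate]
  exact h a

theorem isRightPrimitive_two_order64 : order64.IsRightPrimitive (2#6 : BitVec 6) := by
  have h : ∀ x : BitVec 6, x ≠ 0#6 → ∃ n < 63, (BitVec.semifieldMul · 2#6)^[n] 2#6 = x := by
    decide +kernel
  intro x hx
  obtain ⟨n, -, hn⟩ := h x hx
  exact ⟨n, (rpow_eq_iterate _ _ _).trans hn⟩

end FiniteSemifield

/-- There exists a one-sided nonprimitive finite semifield of order 64: it has a
left-primitive element or a right-primitive element, but not both. -/
theorem exists_one_sided_nonprimitive_semifield64 :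
    ∃ S : FiniteSemifield, Nat.card S.D = 64 ∧
      Xor' (∃ a : S.D, S.IsLeftPrimitive a) (∃ a : S.D, S.IsRightPrimitive a) := by
  refine ⟨.order64, FiniteSemifield.card_order64,
    Or.inr ⟨⟨_, FiniteSemifield.isRightPrimitive_two_order64⟩, ?_⟩⟩
  rintro ⟨a, ha⟩
  obtain ⟨m, hm, h⟩ := FiniteSemifield.exists_lpow_eq_order64 a
  refine FiniteSemifield.not_isLeftPrimitive_of_lpow_eq _ m.succ_pos ?_ h ha
  rw [FiniteSemifield.card_order64]
  omega
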